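/- arXiv:1008.2025 — 3 statements merged into one kernel-verified Lean document; each statement's English description precedes it below -/
import Mathlib

section
/- Let D ≥ 2, let A_1, …, A_m ⊆ ℝ^D and C_1, …, C_m ⊆ ℝ^D be two families of nonempty open sets, each family pairwise disjoint, let n_1, …, n_m and p_1, …, p_m be natural numbers with ∑_{j=1}^m n_j = ∑_{j=1}^m p_j = N ≥ 1, and let t_i < t_f be real numbers. Then there exist points a_1, …, a_N, b_1, …, b_N ∈ ℝ^D and functions σ, τ : {1,…,N} → {1,…,m} with |σ^{-1}(j)| = n_j, |τ^{-1}(j)| = p_j, a_k ∈ A_{σ(k)}, and b_k ∈ C_{τ(k)} for all k, j, such that the straight-line trajectories x_k(t) = a_k + ((t − t_i)/(t_f − t_i))·(b_k − a_k) are pairwise non-colliding: for all k ≠ l and all t ∈ [t_i, t_f], x_k(t) ≠ x_l(t). -/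
theorem exists_injective_choice (N : ℕ) (S : Fin N → Set ℝ) (hS : ∀ k, (S k).Infinite) :
    ∃ f : Fin N → ℝ, Function.Injective f ∧ ∀ k, f k ∈ S k := by
  induction N with
  | zero => exact ⟨fun _ => 0, fun i => i.elim0, fun i => i.elim0⟩
  | succ N ih =>
    obtain ⟨f, hf, hfS⟩ := ih (fun k => S k.succ) (fun k => hS _)
    obtain ⟨x, hx, hx'⟩ := (hS 0).exists_notMem_finite (Set.finite_range f)
    refine ⟨Fin.cons x f, Fin.cons_injective_iff.2 ⟨hx', hf⟩, fun k => ?_⟩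
    refine Fin.cases ?_ (fun i => ?_) k
    · simpa using hx
    · simpa using hfS i

/-- Points can be distributed with prescribed occupation numbers and ordered by one coordinate. -/
theorem exists_sorted_points (D m N : ℕ) (i₀ : Fin D)
    (A : Fin m → Set (EuclideanSpace ℝ (Fin D)))
    (hAopen : ∀ j, IsOpen (A j)) (hAne : ∀ j, (A j).Nonempty)
    (n : Fin m → ℕ) (hn : ∑ j, n j = N) :
    ∃ (a : Fin N → EuclideanSpace ℝ (Fin D)) (σ : Fin N → Fin m),
      (∀ j, {k | σ k = j}.ncard = n j) ∧ (∀ k, a k ∈ A (σ k)) ∧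
      StrictMono (fun k => a k i₀) := by
  subst hn
  let e : (Σ j, Fin (n j)) ≃ Fin (∑ j, n j) := finSigmaFinEquiv
  have hinf : ∀ j, ((fun x : EuclideanSpace ℝ (Fin D) => x i₀) '' A j).Infinite := by
    intro j
    obtain ⟨x, hx⟩ := hAne j
    let g : ℝ → EuclideanSpace ℝ (Fin D) := fun s => x + s • EuclideanSpace.single i₀ (1:ℝ)
    have hg : Continuous g := by fun_prop
    have ho : IsOpen (g ⁻¹' A j) := (hAopen j).preimage hg
    have h0 : (0:ℝ) ∈ g ⁻¹' A j := by simpa [g] using hx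
    have hi : (g ⁻¹' A j).Infinite := infinite_of_mem_nhds 0 (ho.mem_nhds h0)
    have hinj : Function.Injective (fun s => g s i₀) := by
      intro s t hst
      simpa [g] using hst
    refine (hi.image hinj.injOn).mono ?_
    rintro _ ⟨s, hs, rfl⟩
    exact ⟨g s, hs, rfl⟩
  obtain ⟨f, hf, hfS⟩ := exists_injective_choice _
    (fun k => (fun x : EuclideanSpace ℝ (Fin D) => x i₀) '' A (e.symm k).1) (fun k => hinf _)
  choose a ha haf using hfS
  refine ⟨fun k => a (Tuple.sort f k), fun k => (e.symm (Tuple.sort f k)).1, ?_, fun k => ha _, ?_⟩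
  · intro j
    let E : Fin (n j) → Fin (∑ j, n j) := fun i => (Tuple.sort f).symm (e ⟨j, i⟩)
    have hE : Function.Injective E := by
      intro x y hxy
      simpa [E] using hxy
    have : {k | (e.symm (Tuple.sort f k)).1 = j} = Set.range E := by
      ext k
      constructor
      · rintro rfl
        exact ⟨(e.symm (Tuple.sort f k)).2, by simp [E]⟩
      · rintro ⟨i, rfl⟩
        simp [E]
    rw [this, ← Set.image_univ, Set.ncard_image_of_injective _ hE]
    simp
  · have h1 := (Tuple.monotone_sort f).strictMono_of_injective (hf.comp (Tuple.sort f).injective)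
    intro k l hkl
    have := h1 hkl
    simp only [haf]
    exact this

/-- Given two pairwise disjoint families of nonempty open sets in `ℝ^D` (`D ≥ 2`) and
prescribed occupation numbers summing to `N`, one can choose initial points `a_k` and
final points `b_k` distributed accordingly such that the `N` straight-line trajectories
from `a_k` at time `t_i` to `b_k` at time `t_f` are pairwise non-colliding. -/
theorem noncolliding_straight_line_trajectories
    (D m N : ℕ) (hD : 2 ≤ D) (hN : 1 ≤ N)
    (A C : Fin m → Set (EuclideanSpace ℝ (Fin D)))
    (hAopen : ∀ j, IsOpen (A j)) (hAne : ∀ j, (A j).Nonempty)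
    (hCopen : ∀ j, IsOpen (C j)) (hCne : ∀ j, (C j).Nonempty)
    (hAdisj : ∀ i j, i ≠ j → Disjoint (A i) (A j))
    (hCdisj : ∀ i j, i ≠ j → Disjoint (C i) (C j))
    (n p : Fin m → ℕ) (hn : ∑ j, n j = N) (hp : ∑ j, p j = N)
    (ti tf : ℝ) (htitf : ti < tf) :
    ∃ (a b : Fin N → EuclideanSpace ℝ (Fin D)) (σ τ : Fin N → Fin m),
      (∀ j, {k | σ k = j}.ncard = n j) ∧
      (∀ j, {k | τ k = j}.ncard = p j) ∧
      (∀ k, a k ∈ A (σ k)) ∧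
      (∀ k, b k ∈ C (τ k)) ∧
      (∀ k l, k ≠ l → ∀ t ∈ Set.Icc ti tf,
        a k + ((t - ti) / (tf - ti)) • (b k - a k) ≠
          a l + ((t - ti) / (tf - ti)) • (b l - a l)) := by
  let i₀ : Fin D := ⟨0, by omega⟩
  obtain ⟨a, σ, hσ, ha, hsa⟩ := exists_sorted_points D m N i₀ A hAopen hAne n hn
  obtain ⟨b, τ, hτ, hb, hsb⟩ := exists_sorted_points D m N i₀ C hCopen hCne p hp
  refine ⟨a, b, σ, τ, hσ, hτ, ha, hb, ?_⟩
  have key : ∀ k l, k < l → ∀ t ∈ Set.Icc ti tf,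
        a k + ((t - ti) / (tf - ti)) • (b k - a k) ≠
          a l + ((t - ti) / (tf - ti)) • (b l - a l) := by
    intro k l hkl t ht heq
    have h := congrArg (fun x : EuclideanSpace ℝ (Fin D) => x i₀) heq
    have h1 : a k i₀ < a l i₀ := hsa hkl
    have h2 : b k i₀ < b l i₀ := hsb hkl
    have hs0 : 0 ≤ (t - ti) / (tf - ti) := div_nonneg (by linarith [ht.1]) (by linarith)
    have hs1 : (t - ti) / (tf - ti) ≤ 1 := (div_le_one (by linarith)).2 (by linarith [ht.2])
    generalize (t - ti) / (tf - ti) = s at *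
    simp only [PiLp.add_apply, PiLp.smul_apply, PiLp.sub_apply, smul_eq_mul] at h
    rcases hs0.eq_or_lt with h0 | h0
    · subst h0
      linarith
    · nlinarith [mul_pos h0 (sub_pos.2 h2), mul_nonneg (sub_nonneg.2 hs1) (sub_pos.2 h1).le]
  intro k l hkl t ht
  rcases lt_or_gt_of_ne hkl with h | h
  · exact key k l h t ht
  · exact (key l k h t ht).symm
end

section
/- Let D ≥ 1, let U : ℝ^D → ℝ and f : ℝ^D → ℝ be twice continuously differentiable, let λ > 0, and define V_λ : ℝ^D → ℝ by V_λ(q) = U(q)·(1 − e^{−λ f(q)}). Suppose q₀ ∈ ℝ^D satisfies f(q₀) = 0 and f'(q₀) = 0. Then V_λ(q₀) = 0, the first derivative of V_λ vanishes at q₀ (so q₀ is an equilibrium of the force −∇V_λ), and the second derivative of V_λ at q₀ equals λ·U(q₀) times the second derivative of f at q₀: V_λ''(q₀)(v, w) = λ·U(q₀)·f''(q₀)(v, w) for all v, w ∈ ℝ^D. -/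
/-- At a point `q₀` on a scratch (`f(q₀) = 0`, `f'(q₀) = 0`), the single-scratch
scratched potential `V_λ(q) = U(q)(1 − e^{−λ f(q)})` vanishes, has vanishing first
derivative (so `q₀` is an equilibrium), and its Hessian equals `λ · U(q₀)` times the
Hessian of `f`. -/
theorem scratched_potential_hessian_on_scratch
    (D : ℕ) (hD : 1 ≤ D)
    (U f : EuclideanSpace ℝ (Fin D) → ℝ)
    (hU : ContDiff ℝ 2 U) (hf : ContDiff ℝ 2 f)
    (lam : ℝ) (hlam : 0 < lam)
    (V : EuclideanSpace ℝ (Fin D) → ℝ)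
    (hV : ∀ q, V q = U q * (1 - Real.exp (-lam * f q)))
    (q₀ : EuclideanSpace ℝ (Fin D)) (h0 : f q₀ = 0) (h1 : fderiv ℝ f q₀ = 0) :
    V q₀ = 0 ∧
    fderiv ℝ V q₀ = 0 ∧
    (∀ v w, fderiv ℝ (fderiv ℝ V) q₀ v w =
      lam * U q₀ * fderiv ℝ (fderiv ℝ f) q₀ v w) := by
  have hVe : V = fun q => U q * (1 - Real.exp (-lam * f q)) := funext hV
  have hUd : ∀ q, HasFDerivAt U (fderiv ℝ U q) q := fun q =>
    (hU.differentiable (by norm_num) q).hasFDerivAt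
  have hfd : ∀ q, HasFDerivAt f (fderiv ℝ f q) q := fun q =>
    (hf.differentiable (by norm_num) q).hasFDerivAt
  have hU2 : HasFDerivAt (fderiv ℝ U) (fderiv ℝ (fderiv ℝ U) q₀) q₀ :=
    ((hU.fderiv_right (m := 1) (by norm_num)).differentiable (by norm_num) q₀).hasFDerivAt
  have hf2 : HasFDerivAt (fderiv ℝ f) (fderiv ℝ (fderiv ℝ f) q₀) q₀ :=
    ((hf.fderiv_right (m := 1) (by norm_num)).differentiable (by norm_num) q₀).hasFDerivAt
  have hg : ∀ q, HasFDerivAt (fun q => 1 - Real.exp (-lam * f q))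
      (-(Real.exp (-lam * f q) • (-lam) • fderiv ℝ f q)) q := fun q =>
    (((hfd q).const_mul (-lam)).exp).const_sub 1
  have hV1 : fderiv ℝ V = fun q =>
      U q • (-(Real.exp (-lam * f q) • (-lam) • fderiv ℝ f q)) +
        (1 - Real.exp (-lam * f q)) • fderiv ℝ U q := by
    funext q
    rw [hVe]
    exact ((hUd q).mul (hg q)).fderiv
  refine ⟨by simp [hV, h0], by simp [hV1, h0, h1], ?_⟩
  intro v w
  have he : HasFDerivAt (fun q => Real.exp (-lam * f q))
      (Real.exp (-lam * f q₀) • (-lam) • fderiv ℝ f q₀) q₀ :=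
    ((hfd q₀).const_mul (-lam)).exp
  have h2 := ((hUd q₀).smul ((he.smul (hf2.const_smul (-lam))).neg)).add ((hg q₀).smul hU2)
  have hVfun : fderiv ℝ V = U • -((fun q => Real.exp (-lam * f q)) • -lam • fderiv ℝ f) +
      (fun q => 1 - Real.exp (-lam * f q)) • fderiv ℝ U := hV1
  rw [hVfun, h2.fderiv]
  simp [h0, h1]
  ring
end

section
/- Let D ≥ 3, let B ⊆ ℝ^D be an open path-connected set, and let γ : [0,1] → B be a continuous injective map (a simple path in B). Then B ∖ γ([0,1]) is an open path-connected subset of ℝ^D. -/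
open Set Topology

namespace ArcCompl

/-- Circle-valued continuous maps on `X` lift to real-valued ones. -/
def Lifts (X : Type*) [TopologicalSpace X] : Prop :=
  ∀ F : C(X, Circle), ∃ L : C(X, ℝ), ∀ x, Circle.exp (L x) = F x

/-- The same for maps continuous on a set. -/
def LiftsOn {X : Type*} [TopologicalSpace X] (U : Set X) : Prop :=
  ∀ F : X → Circle, ContinuousOn F U →
    ∃ L : X → ℝ, ContinuousOn L U ∧ ∀ x ∈ U, Circle.exp (L x) = F x

lemma const_of_exp_eq_one {X : Type*} [TopologicalSpace X] {S : Set X} (hS : IsPreconnected S)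
    {k : X → ℝ} (hk : ContinuousOn k S) (h1 : ∀ x ∈ S, Circle.exp (k x) = 1)
    {p q : X} (hp : p ∈ S) (hq : q ∈ S) : k p = k q := by
  refine hS.constant_of_mapsTo (T := (AddSubgroup.zmultiples (2 * Real.pi) : Set ℝ)) ⟨?_⟩ hk ?_ hp hq
  · exact inferInstanceAs (DiscreteTopology (AddSubgroup.zmultiples (2 * Real.pi)))
  intro x hx
  obtain ⟨n, hn⟩ := Circle.exp_eq_one.1 (h1 x hx)
  exact ⟨n, by simp [hn]⟩

lemma lifts_of_simplyConnected (X : Type*) [TopologicalSpace X] [SimplyConnectedSpace X]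
    [LocallyPathConnectedSpace X] : Lifts X := by
  intro F
  obtain ⟨a⟩ : Nonempty X := inferInstance
  obtain ⟨e, he⟩ : ∃ e, Circle.exp e = F a := ⟨_, Circle.exp_arg (F a)⟩
  obtain ⟨L, ⟨_, hL⟩, _⟩ := Circle.isCoveringMap_exp.existsUnique_continuousMap_lifts F a e he
  exact ⟨L, fun x => congrFun hL x⟩

lemma liftsOn_of_lifts {X : Type*} [TopologicalSpace X] {U : Set X} (h : Lifts U) :
    LiftsOn U := by
  classical
  intro F hF
  obtain ⟨L, hL⟩ := h ⟨U.domRestrict F, hF.domRestrict⟩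
  have hr : ∀ x (hx : x ∈ U), (fun x => if hx : x ∈ U then L ⟨x, hx⟩ else 0) x = L ⟨x, hx⟩ :=
    fun x hx => dif_pos hx
  refine ⟨fun x => if hx : x ∈ U then L ⟨x, hx⟩ else 0, ?_, ?_⟩
  · rw [continuousOn_iff_continuous_domRestrict]
    convert L.continuous using 1
    ext x
    exact hr x x.2
  · intro x hx
    simp only [hx, dif_pos]
    exact hL ⟨x, hx⟩

lemma lifts_of_liftsOn {X : Type*} [TopologicalSpace X] {U : Set X} (h : LiftsOn U) :
    Lifts U := by
  classical
  intro F
  have hr : ∀ x (hx : x ∈ U), (fun x => if hx : x ∈ U then F ⟨x, hx⟩ else 1) x = F ⟨x, hx⟩ :=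
    fun x hx => dif_pos hx
  obtain ⟨L, hLc, hL⟩ := h (fun x => if hx : x ∈ U then F ⟨x, hx⟩ else 1) (by
    rw [continuousOn_iff_continuous_domRestrict]
    convert F.continuous using 1
    ext x
    exact congrArg _ (hr x x.2))
  refine ⟨⟨U.domRestrict L, hLc.domRestrict⟩, fun x => ?_⟩
  exact (hL x x.2).trans (hr x x.2)

lemma LiftsOn.union {X : Type*} [TopologicalSpace X] {U V : Set X} (hU : IsOpen U)
    (hV : IsOpen V) (hc : IsConnected (U ∩ V)) (lU : LiftsOn U) (lV : LiftsOn V) :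
    LiftsOn (U ∪ V) := by
  classical
  intro F hF
  obtain ⟨L, hLc, hL⟩ := lU F (hF.mono subset_union_left)
  obtain ⟨M, hMc, hM⟩ := lV F (hF.mono subset_union_right)
  obtain ⟨a, ha⟩ := hc.nonempty
  have key : ∀ x ∈ U ∩ V, L x = M x + (L a - M a) := by
    intro x hx
    have := const_of_exp_eq_one hc.isPreconnected (k := fun x => L x - M x)
      ((hLc.mono inter_subset_left).sub (hMc.mono inter_subset_right))
      (fun y hy => by simp [Circle.exp_sub, hL y hy.1, hM y hy.2]) hx ha
    linarith
  have ea : Circle.exp (L a - M a) = 1 := by simp [Circle.exp_sub, hL a ha.1, hM a ha.2]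
  let N : X → ℝ := fun x => if x ∈ U then L x else M x + (L a - M a)
  have NU : ∀ x ∈ U, N x = L x := fun x hx => if_pos hx
  have NV : ∀ x ∈ V, N x = M x + (L a - M a) := by
    intro x hx
    by_cases hxU : x ∈ U
    · rw [NU x hxU, key x ⟨hxU, hx⟩]
    · exact if_neg hxU
  refine ⟨N, ?_, ?_⟩
  · apply ContinuousOn.union_of_isOpen _ _ hU hV
    · exact hLc.congr NU
    · exact (hMc.add continuousOn_const).congr NV
  · rintro x (hx | hx)
    · rw [NU x hx, hL x hx]
    · rw [NV x hx, Circle.exp_add, ea, hM x hx, mul_one]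

/-- Mayer-Vietoris type statement. -/
lemma joinedIn_inter {X : Type*} [TopologicalSpace X] [NormalSpace X]
    [LocallyPathConnectedSpace X] (hX : Lifts X) {U V : Set X} (hU : IsOpen U) (hV : IsOpen V)
    (hUV : U ∪ V = univ) {p q : X} (hpU : JoinedIn U p q) (hpV : JoinedIn V p q) :
    JoinedIn (U ∩ V) p q := by
  classical
  by_contra hcon
  set W := U ∩ V with hW
  have hWo : IsOpen W := hU.inter hV
  set Q := pathComponentIn W q with hQ
  have hqW : q ∈ W := ⟨hpU.target_mem, hpV.target_mem⟩
  have hqQ : q ∈ Q := mem_pathComponentIn_self hqW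
  have hpQ : p ∉ Q := fun h => hcon (JoinedIn.symm h)
  have hQo : IsOpen Q := hWo.pathComponentIn q
  have hfr : ∀ x ∈ frontier Q, x ∉ W := by
    intro x hx hxW
    rw [hQo.frontier_eq] at hx
    obtain ⟨y, hy1, hy2⟩ := mem_closure_iff.1 hx.1 _ (hWo.pathComponentIn x)
      (mem_pathComponentIn_self hxW)
    exact hx.2 (JoinedIn.trans hy2 (JoinedIn.symm hy1))
  have hQW : Q ⊆ W := pathComponentIn_subset
  obtain ⟨f, f0, f1, -⟩ := exists_continuous_zero_one_of_isClosed
    (s := Vᶜ) (t := Uᶜ) hV.isClosed_compl hU.isClosed_compl (by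
      rw [Set.disjoint_iff]
      rintro x ⟨h1, h2⟩
      have : x ∈ U ∪ V := hUV ▸ mem_univ x
      exact this.elim h2 h1)
  have f0' : ∀ x, x ∉ V → f x = 0 := fun x hx => f0 hx
  have f1' : ∀ x, x ∉ U → f x = 1 := fun x hx => f1 hx
  have hFc : Continuous (fun x => if x ∈ Q then Circle.exp (2 * Real.pi * f x) else 1) := by
    refine Continuous.if ?_ (by fun_prop) continuous_const
    intro x hx
    have hxW := hfr x hx
    by_cases hxU : x ∈ U
    · have : x ∉ V := fun h => hxW ⟨hxU, h⟩
      simp [f0' x this]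
    · simp [f1' x hxU]
  obtain ⟨L, hL⟩ := hX ⟨_, hFc⟩
  simp only [ContinuousMap.coe_mk] at hL
  -- the two local branches
  have main : ∀ (T : Set X) (c : ℝ), Circle.exp (2 * Real.pi * c) = 1 →
      (∀ x ∈ T, x ∉ W → f x = c) → JoinedIn T p q →
      L p = L q - 2 * Real.pi * (f q - c) := by
    intro T c hc hT hj
    have hconn : IsPreconnected (range hj.somePath) :=
      isPreconnected_range hj.somePath.continuous
    have hsub : range hj.somePath ⊆ T := by
      rintro _ ⟨t, rfl⟩
      exact hj.somePath_mem t
    have := const_of_exp_eq_one hconn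
      (k := fun x => L x - if x ∈ Q then 2 * Real.pi * (f x - c) else 0) (p := p) (q := q)
      (by
        refine L.continuous.continuousOn.sub ?_
        refine ContinuousOn.if ?_ (by fun_prop) (by fun_prop)
        rintro x ⟨hx, hxf⟩
        simp [hT x (hsub hx) (hfr x hxf)])
      (by
        intro x hx
        rw [Circle.exp_sub, hL x]
        by_cases hxQ : x ∈ Q
        · simp [hxQ, mul_sub, Circle.exp_sub, hc]
        · simp [hxQ])
      ⟨0, by simp⟩ ⟨1, by simp⟩
    simpa [hpQ, hqQ] using this
  have h0 := main U 0 (by simp) (fun x hx hxW => f0' x fun h => hxW ⟨hx, h⟩) hpU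
  have h1 := main V 1 (by simp) (fun x hx hxW => f1' x fun h => hxW ⟨h, hx⟩) hpV
  have := Real.pi_pos
  linarith

/-- Set version. -/
lemma joinedIn_inter' {E : Type*} [MetricSpace E] [LocallyPathConnectedSpace E] {X : Set E}
    (hXo : IsOpen X) (hX : LiftsOn X) {U V : Set E} (hU : IsOpen U) (hV : IsOpen V)
    (hUV : U ∪ V = X) {p q : E} (hpU : JoinedIn U p q) (hpV : JoinedIn V p q) :
    JoinedIn (U ∩ V) p q := by
  have : LocallyPathConnectedSpace X := hXo.locallyPathConnectedSpace
  have hUX : U ⊆ X := hUV ▸ subset_union_left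
  have hVX : V ⊆ X := hUV ▸ subset_union_right
  have lift : ∀ (T : Set E) (hT : T ⊆ X) (h : JoinedIn T p q),
      JoinedIn ((↑) ⁻¹' T : Set X) ⟨p, hT h.source_mem⟩ ⟨q, hT h.target_mem⟩ := by
    intro T hT h
    refine ⟨⟨⟨fun t => ⟨h.somePath t, hT (h.somePath_mem t)⟩, by fun_prop⟩, ?_, ?_⟩, ?_⟩
    · simp
    · simp
    · intro t
      exact h.somePath_mem t
  have := joinedIn_inter (lifts_of_liftsOn hX) (hU.preimage continuous_subtype_val)
    (hV.preimage continuous_subtype_val) (by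
      ext x
      have : (x : E) ∈ U ∪ V := hUV ▸ x.2
      simpa using this) (lift U hUX hpU) (lift V hVX hpV)
  refine (this.map continuous_subtype_val).mono ?_
  rintro _ ⟨x, hx, rfl⟩
  exact hx

section Euclid
variable {D : ℕ}

lemma liftsOn_star {s : Set (EuclideanSpace ℝ (Fin D))} (hs : IsOpen s)
    {x : EuclideanSpace ℝ (Fin D)} (hx : x ∈ s) (h : StarConvex ℝ x s) : LiftsOn s := by
  have := h.contractibleSpace ⟨x, hx⟩
  have := hs.locallyPathConnectedSpace
  exact liftsOn_of_lifts (lifts_of_simplyConnected s)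

/-- Complement of a half-axis. -/
def slit (j : Fin D) (σ : ℝ) : Set (EuclideanSpace ℝ (Fin D)) :=
  {x | σ * x j < 0 ∨ ∃ i, i ≠ j ∧ x i ≠ 0}

lemma isOpen_slit (j : Fin D) (σ : ℝ) : IsOpen (slit j σ) := by
  have : slit j σ = {x : EuclideanSpace ℝ (Fin D) | σ * x j < 0} ∪
      ⋃ i, ⋃ (_ : i ≠ j), {x : EuclideanSpace ℝ (Fin D) | x i ≠ 0} := by
    ext x
    simp [slit]
  rw [this]
  refine (isOpen_lt (by fun_prop) continuous_const).union
    (isOpen_iUnion fun i => isOpen_iUnion fun _ => isOpen_ne_fun (by fun_prop) continuous_const)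

lemma liftsOn_slit (j : Fin D) {σ : ℝ} (hσ : σ ≠ 0) : LiftsOn (slit j σ) := by
  have h2 : 0 < σ * σ := mul_self_pos.2 hσ
  refine liftsOn_star (isOpen_slit j σ) (x := EuclideanSpace.single j (-σ)) (Or.inl (by simpa)) ?_
  rintro y hy a b ha hb hab
  rcases hb.eq_or_lt with rfl | hb
  · obtain rfl : a = 1 := by linarith
    left
    simpa
  · rcases hy with hy | ⟨i, hi, hy⟩
    · left
      simp
      nlinarith [mul_nonneg ha h2.le, mul_neg_of_pos_of_neg hb hy]
    · right
      refine ⟨i, hi, ?_⟩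
      simp [hi, hb.ne', hy]

lemma liftsOn_compl_zero (hD : 3 ≤ D) : LiftsOn ({0}ᶜ : Set (EuclideanSpace ℝ (Fin D))) := by
  let j : Fin D := ⟨0, by omega⟩
  have hu : ({0}ᶜ : Set (EuclideanSpace ℝ (Fin D))) = slit j 1 ∪ slit j (-1) := by
    ext x
    simp only [mem_compl_iff, mem_singleton_iff, slit, mem_union, mem_ofPred_eq]
    constructor
    · intro hx
      by_contra hcon
      push Not at hcon
      apply hx
      ext i
      by_cases hi : i = j
      · subst hi
        have h1 := hcon.1.1
        have h2 := hcon.2.1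
        simp only [PiLp.zero_apply]
        linarith
      · exact hcon.1.2 i hi
    · rintro h rfl
      simp at h
  rw [hu]
  refine LiftsOn.union (isOpen_slit _ _) (isOpen_slit _ _) ?_
    (liftsOn_slit _ (by norm_num)) (liftsOn_slit _ (by norm_num))
  let e : EuclideanSpace ℝ (Fin D) := EuclideanSpace.single j 1
  have hi : slit j 1 ∩ slit j (-1) = ((ℝ ∙ e : Submodule ℝ (EuclideanSpace ℝ (Fin D))) : Set _)ᶜ := by
    ext x
    simp only [mem_compl_iff, SetLike.mem_coe, Submodule.mem_span_singleton, slit, mem_inter_iff,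
      mem_ofPred_eq]
    constructor
    · rintro ⟨h1, h2⟩ ⟨a, rfl⟩
      have hz : ∀ i, i ≠ j → (a • e) i = 0 := by
        intro i hi
        simp [e, hi]
      rcases h1 with h1 | ⟨i, hi, h⟩
      · rcases h2 with h2 | ⟨i, hi, h⟩
        · linarith
        · exact h (hz i hi)
      · exact h (hz i hi)
    · intro h
      have : ∃ i, i ≠ j ∧ x i ≠ 0 := by
        by_contra hcon
        push Not at hcon
        apply h
        refine ⟨x j, ?_⟩
        ext i
        by_cases hi : i = j
        · subst hi
          simp [e]
        · simp [e, hi, hcon i hi]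
      exact ⟨Or.inr this, Or.inr this⟩
  rw [hi]
  refine (isPathConnected_compl_of_one_lt_codim ?_).isConnected
  have he : e ≠ 0 := by simp [e]
  have h1 := Submodule.finrank_quotient_add_finrank (ℝ ∙ e)
  rw [finrank_span_singleton he, finrank_euclideanSpace_fin] at h1
  rw [← Module.finrank_eq_rank]
  have : 1 < Module.finrank ℝ (EuclideanSpace ℝ (Fin D) ⧸ (ℝ ∙ e)) := by omega
  exact_mod_cast this

lemma liftsOn_compl_singleton (hD : 3 ≤ D) (c : EuclideanSpace ℝ (Fin D)) :
    LiftsOn ({c}ᶜ : Set (EuclideanSpace ℝ (Fin D))) := by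
  intro F hF
  obtain ⟨L, hLc, hL⟩ := liftsOn_compl_zero hD (fun x => F (x + c)) (by
    refine hF.comp (by fun_prop) ?_
    intro x hx
    simpa using hx)
  refine ⟨fun x => L (x - c), hLc.comp (by fun_prop) ?_, ?_⟩
  · intro x hx
    simpa [sub_eq_zero] using hx
  · intro x hx
    rw [hL (x - c) (by simpa [sub_eq_zero] using hx)]
    simp

lemma joinedIn_compl_arc (hD : 3 ≤ D) (γ : ℝ → EuclideanSpace ℝ (Fin D))
    (hγcont : ContinuousOn γ (Set.Icc 0 1)) (hγinj : Set.InjOn γ (Set.Icc 0 1))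
    {p q : EuclideanSpace ℝ (Fin D)} (hp : p ∉ γ '' Icc 0 1) (hq : q ∉ γ '' Icc 0 1) :
    JoinedIn (γ '' Icc 0 1)ᶜ p q := by
  have hcl : ∀ a b : ℝ, 0 ≤ a → b ≤ 1 → IsClosed (γ '' Icc a b) := fun a b ha hb =>
    (isCompact_Icc.image_of_continuousOn (hγcont.mono (Icc_subset_Icc ha hb))).isClosed
  have hrank : 1 < Module.rank ℝ (EuclideanSpace ℝ (Fin D)) := by
    rw [← Module.finrank_eq_rank, finrank_euclideanSpace_fin]
    exact_mod_cast (by omega : 1 < D)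
  -- gluing step
  have step : ∀ a m b : ℝ, 0 ≤ a → a ≤ m → m ≤ b → b ≤ 1 → JoinedIn (γ '' Icc a m)ᶜ p q →
      JoinedIn (γ '' Icc m b)ᶜ p q → JoinedIn (γ '' Icc a b)ᶜ p q := by
    intro a m b ha ham hmb hb h1 h2
    have := joinedIn_inter' (isOpen_compl_singleton) (liftsOn_compl_singleton hD (γ m))
      (hcl a m ha (hmb.trans hb)).isOpen_compl (hcl m b (ha.trans ham) hb).isOpen_compl (by
        rw [← compl_inter, compl_inj_iff,
          ← hγinj.image_inter (Icc_subset_Icc ha (hmb.trans hb)) (Icc_subset_Icc (ha.trans ham) hb)]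
        have : Icc a m ∩ Icc m b = {m} := by
          ext x
          simp only [mem_inter_iff, mem_Icc, mem_singleton_iff]
          constructor
          · rintro ⟨⟨_, _⟩, _, _⟩
            linarith
          · rintro rfl
            exact ⟨⟨ham, le_rfl⟩, le_rfl, hmb⟩
        rw [this, image_singleton]) h1 h2
    rwa [← compl_union, ← image_union, Icc_union_Icc_eq_Icc ham hmb] at this
  have hγI : Continuous (fun t : unitInterval => γ t) := hγcont.domRestrict
  obtain ⟨t, ht0, htm, ⟨N, hN⟩, ht⟩ := exists_monotone_Icc_subset_open_cover_unitInterval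
    (c := fun δ : Path p q => (fun t : unitInterval => γ t) ⁻¹' (range δ)ᶜ)
    (fun δ => (isCompact_range δ.continuous).isClosed.isOpen_compl.preimage hγI) (by
      intro s _
      have h := (isPathConnected_compl_singleton_of_one_lt_rank hrank (γ s)).joinedIn p
        (fun h => hp ⟨s, s.2, h.symm⟩) q (fun h => hq ⟨s, s.2, h.symm⟩)
      refine mem_iUnion.2 ⟨h.somePath, ?_⟩
      rintro ⟨u, hu⟩
      exact h.somePath_mem u hu)
  have piece : ∀ n, JoinedIn (γ '' Icc (t n : ℝ) (t (n + 1)))ᶜ p q := by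
    intro n
    obtain ⟨δ, hδ⟩ := ht n
    refine ⟨δ, fun u => ?_⟩
    rintro ⟨s, hs, hsu⟩
    have hsI : s ∈ unitInterval := ⟨(t n).2.1.trans hs.1, hs.2.trans (t (n + 1)).2.2⟩
    have hmem : (⟨s, hsI⟩ : unitInterval) ∈ Icc (t n) (t (n + 1)) := ⟨hs.1, hs.2⟩
    exact hδ hmem ⟨u, hsu.symm⟩
  have all : ∀ n, JoinedIn (γ '' Icc (0 : ℝ) (t (n + 1)))ᶜ p q := by
    intro n
    induction n with
    | zero => simpa [ht0] using piece 0
    | succ n ih =>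
      exact step 0 (t (n + 1)) (t (n + 1 + 1)) le_rfl (t _).2.1 (htm (Nat.le_succ _)) (t _).2.2 ih
        (piece (n + 1))
  have := all N
  rwa [hN (N + 1) (Nat.le_succ N)] at this

end Euclid

end ArcCompl

/-- Removing the image of a simple path from an open path-connected set `B ⊆ ℝ^D`
(`D ≥ 3`) leaves an open path-connected set. -/
theorem complement_of_simple_path_is_path_connected
    (D : ℕ) (hD : 3 ≤ D) (B : Set (EuclideanSpace ℝ (Fin D)))
    (hBopen : IsOpen B) (hBpc : IsPathConnected B)
    (γ : ℝ → EuclideanSpace ℝ (Fin D))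
    (hγcont : ContinuousOn γ (Set.Icc 0 1))
    (hγinj : Set.InjOn γ (Set.Icc 0 1))
    (hγB : γ '' Set.Icc 0 1 ⊆ B) :
    IsOpen (B \ γ '' Set.Icc 0 1) ∧ IsPathConnected (B \ γ '' Set.Icc 0 1) := by
  have hK : IsCompact (γ '' Set.Icc 0 1) := isCompact_Icc.image_of_continuousOn hγcont
  refine ⟨hBopen.sdiff hK.isClosed, ?_⟩
  rw [isPathConnected_iff]
  constructor
  · by_contra hne
    rw [Set.not_nonempty_iff_eq_empty, Set.sdiff_eq_empty] at hne
    have hB : B = γ '' Set.Icc 0 1 := hne.antisymm hγB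
    have hcl : IsClopen B := ⟨hB ▸ hK.isClosed, hBopen⟩
    have hu := hcl.eq_univ hBpc.nonempty
    have : Nonempty (Fin D) := ⟨⟨0, by omega⟩⟩
    have hnc : NoncompactSpace (EuclideanSpace ℝ (Fin D)) := NormedSpace.noncompactSpace ℝ _
    exact noncompact_univ (EuclideanSpace ℝ (Fin D)) (hu ▸ hB ▸ hK)
  · intro p hp q hq
    rw [Set.sdiff_eq]
    refine ArcCompl.joinedIn_inter' isOpen_univ ?_ hBopen hK.isClosed.isOpen_compl ?_
      (hBpc.joinedIn p hp.1 q hq.1)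
      (ArcCompl.joinedIn_compl_arc hD γ hγcont hγinj hp.2 hq.2)
    · exact ArcCompl.liftsOn_star isOpen_univ (Set.mem_univ 0) (starConvex_univ 0)
    · rw [Set.eq_univ_iff_forall]
      intro x
      by_cases hx : x ∈ γ '' Set.Icc 0 1
      · exact Or.inl (hγB hx)
      · exact Or.inr hx
end
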